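/- arXiv:2512.22847 — 14 statements merged into one kernel-verified Lean document; each statement's English description precedes it below -/
import Mathlib

section
/- Let X and Y be extended pseudometric spaces (PseudoEMetricSpace) and let f : X → Y be a 1-Lipschitz map, i.e. edist (f x) (f x') ≤ edist x x' for all x, x'. Then f is surjective if and only if f is an epimorphism among 1-Lipschitz maps of extended pseudometric spaces; that is, if and only if for every extended pseudometric space Z and all 1-Lipschitz maps g, h : Y → Z, g ∘ f = h ∘ f implies g = h. -/
universe u v

/-- The indiscrete extended pseudometric, in which all distances vanish. -/
noncomputable abbrev indiscretePseudoEMetricSpace (Z : Type*) : PseudoEMetricSpace Z where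
  edist _ _ := 0
  edist_self _ := rfl
  edist_comm _ _ := rfl
  edist_triangle _ _ _ := zero_le

/-- A map between extended pseudometric spaces is surjective if and only if it is an
epimorphism among 1-Lipschitz maps of extended pseudometric spaces. -/
theorem surjective_iff_epi_of_oneLipschitz {X : Type u} {Y : Type v}
    [PseudoEMetricSpace X] [PseudoEMetricSpace Y]
    (f : X → Y) (hf : ∀ x x', edist (f x) (f x') ≤ edist x x') :
    Function.Surjective f ↔
      ∀ (Z : Type (max u v)) (_ : PseudoEMetricSpace Z) (g h : Y → Z),
        (∀ y y', edist (g y) (g y') ≤ edist y y') →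
        (∀ y y', edist (h y) (h y') ≤ edist y y') →
        g ∘ f = h ∘ f → g = h := by
  refine ⟨fun hsurj _ _ _ _ _ _ hgh => hsurj.injective_comp_right hgh, fun hepi y => ?_⟩
  have hrange := hepi (ULift Prop) (indiscretePseudoEMetricSpace _)
    (fun y => ⟨y ∈ Set.range f⟩) (fun _ => ⟨True⟩)
    (fun _ _ => zero_le) (fun _ _ => zero_le)
    (funext fun x => congrArg ULift.up (eq_true (Set.mem_range_self x)))
  exact of_eq_true (congrArg ULift.down (congrFun hrange y))
end

section
/- Let f : X → B be a surjective 1-Lipschitz map between pseudometric spaces. Then f is a submetry if and only if for every point x : X and every real r > 0 the image of the open ball satisfies f '' Metric.ball x r = Metric.ball (f x) r. -/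
/-- A map between pseudometric spaces is a submetry (the paper's H-fibration) if it is
1-Lipschitz, surjective, and the Hausdorff extended distance between any two fibers is
bounded by the distance between the base points. -/
def IsSubmetry {X B : Type*} [PseudoMetricSpace X] [PseudoMetricSpace B] (f : X → B) : Prop :=
  (∀ x x', dist (f x) (f x') ≤ dist x x') ∧ Function.Surjective f ∧
    ∀ b₀ b₁ : B, EMetric.hausdorffEdist (f ⁻¹' {b₀}) (f ⁻¹' {b₁}) ≤ ENNReal.ofReal (dist b₀ b₁)

/-- If the image of every open ball contains the open ball of the same radius around the image
of the center, then each fiber is as close to a point as its base point is to the image. -/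
theorem infEDist_preimage_singleton_le_of_ball_subset_image {X B : Type*} [PseudoMetricSpace X]
    [PseudoMetricSpace B] {f : X → B}
    (h : ∀ (x : X) (r : ℝ), 0 < r → Metric.ball (f x) r ⊆ f '' Metric.ball x r) (x : X) (b : B) :
    Metric.infEDist x (f ⁻¹' {b}) ≤ edist (f x) b := by
  rw [edist_dist]
  refine ENNReal.le_of_forall_pos_le_add fun ε hε _ => ?_
  have hε' : (0 : ℝ) < ε := hε
  have hb : b ∈ Metric.ball (f x) (dist (f x) b + ε) := by
    rw [Metric.mem_ball, dist_comm]
    linarith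
  obtain ⟨y, hy, hfy⟩ := h x _ (by positivity) hb
  calc Metric.infEDist x (f ⁻¹' {b}) ≤ edist x y := Metric.infEDist_le_edist_of_mem hfy
    _ ≤ ENNReal.ofReal (dist (f x) b + ε) := by
        rw [edist_dist]
        exact ENNReal.ofReal_le_ofReal (Metric.mem_ball'.mp hy).le
    _ = ENNReal.ofReal (dist (f x) b) + ε := by
        rw [ENNReal.ofReal_add dist_nonneg hε'.le, ENNReal.ofReal_coe_nnreal]

/-- A surjective 1-Lipschitz map between pseudometric spaces is a submetry iff it maps
every open ball onto the open ball of the same radius around the image of the center. -/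
theorem isSubmetry_iff_image_ball {X B : Type*} [PseudoMetricSpace X]
    [PseudoMetricSpace B] (f : X → B)
    (hlip : ∀ x x', dist (f x) (f x') ≤ dist x x') (hsurj : Function.Surjective f) :
    IsSubmetry f ↔
      ∀ (x : X) (r : ℝ), 0 < r → f '' Metric.ball x r = Metric.ball (f x) r := by
  constructor
  · rintro ⟨-, -, hH⟩ x r hr
    refine Set.Subset.antisymm ?_ fun b hb => ?_
    · rintro _ ⟨y, hy, rfl⟩
      exact (hlip y x).trans_lt hy
    · have hlt : Metric.hausdorffEDist (f ⁻¹' {f x}) (f ⁻¹' {b}) < ENNReal.ofReal r :=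
        (hH (f x) b).trans_lt ((ENNReal.ofReal_lt_ofReal_iff hr).2 (Metric.mem_ball'.mp hb))
      obtain ⟨y, hy, hxy⟩ :=
        Metric.exists_edist_lt_of_hausdorffEDist_lt (Set.mem_preimage.2 rfl : x ∈ f ⁻¹' {f x}) hlt
      rw [edist_dist, ENNReal.ofReal_lt_ofReal_iff hr] at hxy
      exact ⟨y, Metric.mem_ball'.2 hxy, hy⟩
  · intro h
    have key := infEDist_preimage_singleton_le_of_ball_subset_image fun x r hr => (h x r hr).ge
    refine ⟨hlip, hsurj, fun b₀ b₁ => ?_⟩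
    rw [← edist_dist]
    refine Metric.hausdorffEDist_le_of_infEDist ?_ ?_
    · rintro x rfl
      exact key x b₁
    · rintro x rfl
      rw [edist_comm]
      exact key x b₀
end

section
/- Let g : Y → X and f : X → B be 1-Lipschitz maps between pseudometric spaces, and assume that g is a submetry. Then f is a submetry if and only if the composite f ∘ g : Y → B is a submetry. -/
/-- The fiber condition in the definition of a submetry says that every point can be moved into
any given fiber by a distance arbitrarily close to the distance in the base. -/
lemma hausdorffEDist_fiber_le_iff {X B : Type*} [PseudoMetricSpace X] [PseudoMetricSpace B]
    (f : X → B) :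
    (∀ b₀ b₁ : B, Metric.hausdorffEDist (f ⁻¹' {b₀}) (f ⁻¹' {b₁}) ≤ ENNReal.ofReal (dist b₀ b₁)) ↔
      ∀ x b r, dist (f x) b < r → ∃ x', f x' = b ∧ dist x x' < r := by
  constructor
  · intro h x b r hr
    have hlt : Metric.hausdorffEDist (f ⁻¹' {f x}) (f ⁻¹' {b}) < ENNReal.ofReal r :=
      (h _ _).trans_lt ((ENNReal.ofReal_lt_ofReal_iff (dist_nonneg.trans_lt hr)).2 hr)
    obtain ⟨x', hx', hd⟩ :=
      Metric.exists_edist_lt_of_hausdorffEDist_lt (Set.mem_preimage.2 rfl : x ∈ f ⁻¹' {f x}) hlt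
    exact ⟨x', hx', edist_lt_ofReal.1 hd⟩
  · intro h
    have infEDist_le (x : X) (b : B) :
        Metric.infEDist x (f ⁻¹' {b}) ≤ ENNReal.ofReal (dist (f x) b) := by
      refine ENNReal.le_of_forall_pos_le_add fun ε hε _ => ?_
      obtain ⟨x', hx', hd⟩ := h x b (dist (f x) b + ε) (lt_add_of_pos_right _ hε)
      calc Metric.infEDist x (f ⁻¹' {b}) ≤ edist x x' := Metric.infEDist_le_edist_of_mem hx'
        _ ≤ ENNReal.ofReal (dist (f x) b + ε) := (edist_lt_ofReal.2 hd).le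
        _ = ENNReal.ofReal (dist (f x) b) + ε := by
          rw [ENNReal.ofReal_add dist_nonneg ε.coe_nonneg, ENNReal.ofReal_coe_nnreal]
    intro b₀ b₁
    refine Metric.hausdorffEDist_le_of_infEDist ?_ ?_
    · rintro x rfl
      exact infEDist_le x b₁
    · rintro x rfl
      rw [dist_comm]
      exact infEDist_le x b₀

/-- A map is a submetry iff it is 1-Lipschitz, surjective, and lifts points at almost the same
distance. -/
lemma isSubmetry_iff_exists_lift {X B : Type*} [PseudoMetricSpace X] [PseudoMetricSpace B]
    (f : X → B) :
    IsSubmetry f ↔ (∀ x x', dist (f x) (f x') ≤ dist x x') ∧ Function.Surjective f ∧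
      ∀ x b r, dist (f x) b < r → ∃ x', f x' = b ∧ dist x x' < r :=
  and_congr_right' (and_congr_right' (hausdorffEDist_fiber_le_iff f))

/-- If `g` is a submetry, then a 1-Lipschitz map `f` is a submetry iff `f ∘ g` is. -/
theorem isSubmetry_iff_comp_isSubmetry {Y X B : Type*} [PseudoMetricSpace Y]
    [PseudoMetricSpace X] [PseudoMetricSpace B]
    (g : Y → X) (f : X → B)
    (hg : IsSubmetry g) (hf : ∀ x x', dist (f x) (f x') ≤ dist x x') :
    IsSubmetry f ↔ IsSubmetry (f ∘ g) := by
  rw [isSubmetry_iff_exists_lift] at hg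
  obtain ⟨hgl, hgs, hg⟩ := hg
  rw [isSubmetry_iff_exists_lift, isSubmetry_iff_exists_lift]
  constructor
  · rintro ⟨-, hfs, hfl⟩
    refine ⟨fun y y' => (hf _ _).trans (hgl y y'), hfs.comp hgs, fun y b r hr => ?_⟩
    obtain ⟨x, rfl, hx⟩ := hfl (g y) b r hr
    obtain ⟨y', rfl, hy'⟩ := hg y x r hx
    exact ⟨y', rfl, hy'⟩
  · rintro ⟨-, hs, hl⟩
    refine ⟨hf, hs.of_comp, fun x b r hr => ?_⟩
    obtain ⟨y, rfl⟩ := hgs x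
    obtain ⟨y', hy', hd⟩ := hl y b r hr
    exact ⟨g y', hy', (hgl y y').trans_lt hd⟩
end

section
/- Let f : X → B and p : U → X be 1-Lipschitz maps between pseudometric spaces such that the range of p is dense in X. If the composite f ∘ p : U → B is a submetry, then f is a submetry. -/
/-- The distance from a point to a fiber of a submetry is at most the distance in the base. -/
theorem IsSubmetry.infEDist_fiber_le {X B : Type*} [PseudoMetricSpace X] [PseudoMetricSpace B]
    {f : X → B} (hf : IsSubmetry f) (x : X) (b : B) :
    Metric.infEDist x (f ⁻¹' {b}) ≤ edist (f x) b := by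
  rw [edist_dist]
  exact (Metric.infEDist_le_hausdorffEDist_of_mem (s := f ⁻¹' {f x}) rfl).trans (hf.2.2 (f x) b)

/-- A surjective 1-Lipschitz map is a submetry as soon as the distance from any point to any
fiber is at most the distance in the base. -/
theorem IsSubmetry.of_infEDist_fiber_le {X B : Type*} [PseudoMetricSpace X] [PseudoMetricSpace B]
    {f : X → B} (hlip : ∀ x x', dist (f x) (f x') ≤ dist x x') (hsurj : Function.Surjective f)
    (h : ∀ x b, Metric.infEDist x (f ⁻¹' {b}) ≤ edist (f x) b) : IsSubmetry f := by
  refine ⟨hlip, hsurj, fun b₀ b₁ => ?_⟩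
  rw [← edist_dist]
  refine Metric.hausdorffEDist_le_of_infEDist ?_ ?_
  · rintro x rfl
    exact h x b₁
  · rintro x rfl
    exact (h x b₀).trans_eq (edist_comm _ _)

/-- If `p` has dense range and `f ∘ p` is a submetry, then `f` is a submetry. -/
theorem isSubmetry_of_comp_denseRange {U X B : Type*} [PseudoMetricSpace U]
    [PseudoMetricSpace X] [PseudoMetricSpace B]
    (f : X → B) (p : U → X)
    (hf : ∀ x x', dist (f x) (f x') ≤ dist x x')
    (hp : ∀ u u', dist (p u) (p u') ≤ dist u u')
    (hdense : DenseRange p)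
    (hcomp : IsSubmetry (f ∘ p)) : IsSubmetry f := by
  have hfc : Continuous f := (LipschitzWith.of_dist_le_mul (K := 1) (by simpa using hf)).continuous
  have hpl : LipschitzWith 1 p := LipschitzWith.of_dist_le_mul (by simpa using hp)
  refine .of_infEDist_fiber_le hf hcomp.2.1.of_comp fun x b => ?_
  refine hdense.induction_on x
    (isClosed_le Metric.continuous_infEDist (hfc.edist continuous_const)) fun u => ?_
  refine le_trans (Metric.le_infEDist.2 fun v hv => ?_) (hcomp.infEDist_fiber_le u b)
  refine (Metric.infEDist_le_edist_of_mem (y := p v) hv).trans ?_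
  simpa using hpl u v
end

section
/- Let f : X → B be a submetry between pseudometric spaces and let g : B' → B be a 1-Lipschitz map from a pseudometric space B'. Then the natural projection from the fiber product X ×_B B' = {p : X × B' // f p.1 = g p.2} (a subtype of the product X × B' with the max metric) onto B' is a submetry. -/
/-- For `r > edist (f x) b`, the fiber over `b` contains a point at distance less than `r`
from `x`. -/
theorem IsSubmetry.exists_edist_lt {X B : Type*} [PseudoMetricSpace X] [PseudoMetricSpace B]
    {f : X → B} (hf : IsSubmetry f) (x : X) (b : B) {r : ENNReal} (hr : edist (f x) b < r) :
    ∃ y, f y = b ∧ edist x y < r := by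
  have h : Metric.hausdorffEDist (f ⁻¹' {f x}) (f ⁻¹' {b}) < r :=
    (hf.2.2 (f x) b).trans_lt (by rwa [← edist_dist])
  exact Metric.exists_edist_lt_of_hausdorffEDist_lt (s := f ⁻¹' {f x}) rfl h

/-- In the fiber product of a submetry `f` and a 1-Lipschitz map `g`, the distance from a point
to the fiber over `b` is at most the distance between the base points. -/
theorem IsSubmetry.infEDist_fiberProduct_le {X B B' : Type*} [PseudoMetricSpace X]
    [PseudoMetricSpace B] [PseudoMetricSpace B'] {f : X → B} {g : B' → B}
    (hf : IsSubmetry f) (hg : ∀ b b', dist (g b) (g b') ≤ dist b b')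
    (q : {p : X × B' // f p.1 = g p.2}) (b : B') :
    Metric.infEDist q ((fun q : {p : X × B' // f p.1 = g p.2} => q.val.2) ⁻¹' {b}) ≤
      edist q.val.2 b := by
  refine le_of_forall_gt fun r hr => ?_
  have hgr : edist (f q.val.1) (g b) < r := by
    refine lt_of_le_of_lt ?_ hr
    rw [q.property, edist_dist, edist_dist]
    exact ENNReal.ofReal_le_ofReal (hg _ _)
  obtain ⟨y, hy, hxy⟩ := hf.exists_edist_lt q.val.1 (g b) hgr
  exact Metric.infEDist_lt_iff.2 ⟨⟨(y, b), hy⟩, rfl, max_lt hxy hr⟩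

/-- Base change of a submetry along a 1-Lipschitz map is a submetry: the projection from
the fiber product `{p : X × B' // f p.1 = g p.2}` (with the max metric) onto `B'` is a
submetry. -/
theorem IsSubmetry.base_change {X B B' : Type*} [PseudoMetricSpace X]
    [PseudoMetricSpace B] [PseudoMetricSpace B']
    (f : X → B) (g : B' → B)
    (hf : IsSubmetry f) (hg : ∀ b b', dist (g b) (g b') ≤ dist b b') :
    IsSubmetry (fun q : {p : X × B' // f p.1 = g p.2} => q.val.2) := by
  refine ⟨fun q q' => le_max_right _ _, fun b => ?_, fun b₀ b₁ => ?_⟩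
  · obtain ⟨x, hx⟩ := hf.2.1 (g b)
    exact ⟨⟨(x, b), hx⟩, rfl⟩
  · rw [← edist_dist]
    refine Metric.hausdorffEDist_le_of_infEDist ?_ ?_
    · rintro q rfl
      exact hf.infEDist_fiberProduct_le hg q b₁
    · rintro q rfl
      rw [edist_comm]
      exact hf.infEDist_fiberProduct_le hg q b₀
end

section
/- Let f : X → B be a submetry between metric spaces. Then the induced map between completions, UniformSpace.Completion.map f : Completion X → Completion B, is a submetry; in particular, it is surjective. -/
open UniformSpace Filter Topology

/-- A submetry lifts points of the base, moving by less than any strict bound on the distance. -/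
theorem IsSubmetry.exists_lift {X B : Type*} [PseudoMetricSpace X] [PseudoMetricSpace B]
    {f : X → B} (hf : IsSubmetry f) {x : X} {b : B} {r : ℝ} (h : dist (f x) b < r) :
    ∃ y, f y = b ∧ dist x y < r := by
  have hr : 0 < r := dist_nonneg.trans_lt h
  obtain ⟨y, hy, hxy⟩ := Metric.exists_edist_lt_of_hausdorffEDist_lt (x := x)
    (s := f ⁻¹' {f x}) rfl
    ((hf.2.2 (f x) b).trans_lt ((ENNReal.ofReal_lt_ofReal_iff hr).2 h))
  rw [edist_dist, ENNReal.ofReal_lt_ofReal_iff hr] at hxy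
  exact ⟨y, hy, hxy⟩

/-- On a complete space, a continuous map which lifts points of the base up to arbitrarily small
errors lifts them exactly. -/
theorem exists_lift_of_forall_approx_lift {X B : Type*} [PseudoMetricSpace X] [CompleteSpace X]
    [MetricSpace B] {f : X → B} (hf : Continuous f)
    (H : ∀ x b r ε, dist (f x) b < r → 0 < ε → ∃ y, dist (f y) b < ε ∧ dist x y < r)
    {x : X} {b : B} {r : ℝ} (h : dist (f x) b < r) :
    ∃ y, f y = b ∧ dist x y < r := by
  obtain ⟨s, hs, hsr⟩ := exists_between h
  set C := (r - s) / 2 with hC_def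
  have hC : 0 < C := by rw [hC_def]; linarith
  have hpos (n : ℕ) : 0 < C / 2 / 2 ^ n := by positivity
  obtain ⟨y₀, hy₀, hxy₀⟩ := H x b s (C / 2 / 2 ^ 0) hs (hpos 0)
  choose! next hnext hdist using fun (n : ℕ) y (hy : dist (f y) b < C / 2 / 2 ^ n) ↦
    H y b _ (C / 2 / 2 ^ (n + 1)) hy (hpos (n + 1))
  let u : ℕ → X := fun n ↦ Nat.rec y₀ next n
  have hu (n : ℕ) : dist (f (u n)) b < C / 2 / 2 ^ n := by
    induction n with
    | zero => exact hy₀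
    | succ n ih => exact hnext n _ ih
  have hstep (n : ℕ) : dist (u n) (u (n + 1)) ≤ C / 2 / 2 ^ n := (hdist n _ (hu n)).le
  obtain ⟨y, hy⟩ := cauchySeq_tendsto_of_complete (cauchySeq_of_le_geometric_two hstep)
  have hlim : Tendsto (fun n : ℕ ↦ C / 2 / 2 ^ n) atTop (𝓝 0) :=
    tendsto_const_nhds.div_atTop (tendsto_pow_atTop_atTop_of_one_lt one_lt_two)
  refine ⟨y, tendsto_nhds_unique ((hf.tendsto y).comp hy) ?_, ?_⟩
  · exact tendsto_iff_dist_tendsto_zero.2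
      (squeeze_zero (fun _ ↦ dist_nonneg) (fun n ↦ (hu n).le) hlim)
  · have h₀ : dist y₀ y ≤ C := dist_le_of_le_geometric_two_of_tendsto₀ hstep hy
    linarith [dist_triangle x y₀ y]

/-- A surjective 1-Lipschitz map which lifts points of the base is a submetry. -/
theorem IsSubmetry.of_exists_lift {X B : Type*} [PseudoMetricSpace X] [PseudoMetricSpace B]
    {f : X → B} (hf : ∀ x x', dist (f x) (f x') ≤ dist x x') (hs : Function.Surjective f)
    (H : ∀ x b r, dist (f x) b < r → ∃ y, f y = b ∧ dist x y < r) : IsSubmetry f := by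
  have key (b₀ b₁ : B) (x : X) (hx : x ∈ f ⁻¹' {b₀}) :
      Metric.infEDist x (f ⁻¹' {b₁}) ≤ ENNReal.ofReal (dist b₀ b₁) := by
    obtain rfl : f x = b₀ := hx
    refine ENNReal.le_of_forall_pos_le_add fun ε hε _ ↦ ?_
    obtain ⟨y, hy, hxy⟩ := H x b₁ (dist (f x) b₁ + ε) (lt_add_of_pos_right _ hε)
    refine (Metric.infEDist_le_edist_of_mem (s := f ⁻¹' {b₁}) hy).trans ?_
    rw [edist_dist, ← ENNReal.ofReal_coe_nnreal, ← ENNReal.ofReal_add dist_nonneg ε.coe_nonneg]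
    exact ENNReal.ofReal_le_ofReal hxy.le
  refine ⟨hf, hs, fun b₀ b₁ ↦ Metric.hausdorffEDist_le_of_infEDist (key b₀ b₁) ?_⟩
  rw [dist_comm]
  exact key b₁ b₀

/-- The completion of a submetry lifts points of the base up to arbitrarily small errors. -/
theorem IsSubmetry.completion_map_approx_lift {X B : Type*} [PseudoMetricSpace X]
    [PseudoMetricSpace B] {f : X → B} (hf : IsSubmetry f) (x : Completion X) (b : Completion B)
    (r ε : ℝ) (h : dist (Completion.map f x) b < r) (hε : 0 < ε) :
    ∃ y, dist (Completion.map f y) b < ε ∧ dist x y < r := by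
  have hlip : LipschitzWith 1 f := LipschitzWith.mk_one hf.1
  set δ := min ε ((r - dist (Completion.map f x) b) / 4)
  have hδ : 0 < δ := lt_min hε (by linarith)
  have hδr : δ ≤ (r - dist (Completion.map f x) b) / 4 := min_le_right _ _
  obtain ⟨x', hx'⟩ := Completion.denseRange_coe.exists_dist_lt x hδ
  obtain ⟨b', hb'⟩ := Completion.denseRange_coe.exists_dist_lt b hδ
  have hx'b' : dist (f x') b' < dist (Completion.map f x) b + 2 * δ := by
    have h₁ := hlip.completion_map.dist_le_mul x x'
    rw [Completion.map_coe hlip.uniformContinuous, NNReal.coe_one, one_mul] at h₁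
    rw [← Completion.dist_eq]
    linarith [dist_triangle4 (f x' : Completion B) (Completion.map f x) b b',
      dist_comm (f x' : Completion B) (Completion.map f x)]
  obtain ⟨y, rfl, hy⟩ := hf.exists_lift hx'b'
  refine ⟨y, ?_, ?_⟩
  · rw [Completion.map_coe hlip.uniformContinuous, dist_comm]
    exact hb'.trans_le (min_le_left _ _)
  · rw [← Completion.dist_eq] at hy
    linarith [dist_triangle x x' y]

/-- The completion of a submetry between metric spaces is a submetry; in particular,
it is surjective. -/
theorem IsSubmetry.completion_map {X B : Type*} [MetricSpace X] [MetricSpace B]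
    (f : X → B) (hf : IsSubmetry f) :
    IsSubmetry (UniformSpace.Completion.map f) ∧
      Function.Surjective (UniformSpace.Completion.map f) := by
  have hlip : LipschitzWith 1 (Completion.map f) := (LipschitzWith.mk_one hf.1).completion_map
  have lift (x : Completion X) (b : Completion B) (r : ℝ) (h : dist (Completion.map f x) b < r) :
      ∃ y, Completion.map f y = b ∧ dist x y < r :=
    exists_lift_of_forall_approx_lift hlip.continuous hf.completion_map_approx_lift h
  have hsurj : Function.Surjective (Completion.map f) := fun b ↦ by
    obtain ⟨b', -⟩ := Completion.denseRange_coe.exists_dist_lt b one_pos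
    obtain ⟨x, -⟩ := hf.2.1 b'
    obtain ⟨y, hy, -⟩ := lift x b _ (lt_add_one _)
    exact ⟨y, hy⟩
  exact ⟨.of_exists_lift (fun x x' ↦ by simpa using hlip.dist_le_mul x x') hsurj lift, hsurj⟩
end

section
/- Let f : X → B be a submetry between metric spaces. Assume that B is totally bounded (TotallyBounded (Set.univ : Set B)) and that for every b : B the fiber f ⁻¹' {b} is a totally bounded subset of X. Then X is totally bounded. -/
/-- If the base of a submetry is totally bounded and all its fibers are totally bounded,
then the total space is totally bounded. -/
theorem IsSubmetry.totallyBounded {X B : Type*} [MetricSpace X] [MetricSpace B]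
    (f : X → B) (hf : IsSubmetry f)
    (hB : TotallyBounded (Set.univ : Set B))
    (hfib : ∀ b : B, TotallyBounded (f ⁻¹' {b})) :
    TotallyBounded (Set.univ : Set X) := by
  rw [Metric.totallyBounded_iff] at hB ⊢
  intro ε hε
  obtain ⟨t, ht, hBt⟩ := hB (ε / 2) (half_pos hε)
  choose s hs hfs using fun b => Metric.totallyBounded_iff.mp (hfib b) (ε / 2) (half_pos hε)
  refine ⟨⋃ b ∈ t, s b, ht.biUnion fun b _ => hs b, fun x _ => ?_⟩
  obtain ⟨b, hb, hxb⟩ := Set.mem_iUnion₂.mp (hBt (Set.mem_univ (f x)))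
  have hx : x ∈ f ⁻¹' {f x} := rfl
  have hdist : Metric.hausdorffEDist (f ⁻¹' {f x}) (f ⁻¹' {b}) < ENNReal.ofReal (ε / 2) :=
    (hf.2.2 (f x) b).trans_lt ((ENNReal.ofReal_lt_ofReal_iff (half_pos hε)).mpr hxb)
  obtain ⟨y, hy, hxy⟩ := Metric.exists_edist_lt_of_hausdorffEDist_lt hx hdist
  rw [edist_lt_ofReal] at hxy
  obtain ⟨z, hz, hyz⟩ := Set.mem_iUnion₂.mp (hfs b hy)
  refine Set.mem_iUnion₂.mpr ⟨z, Set.mem_biUnion hb hz, ?_⟩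
  rw [Metric.mem_ball] at hyz ⊢
  linarith [dist_triangle x y z]
end

section
/- Let f : X → B be a submetry between metric spaces. Then f is a proper map (IsProperMap f; equivalently, a closed continuous map with compact fibers) if and only if for every b : B the fiber f ⁻¹' {b} is compact. -/
theorem IsSubmetry.lipschitzWith {X B : Type*} [PseudoMetricSpace X] [PseudoMetricSpace B]
    {f : X → B} (hf : IsSubmetry f) : LipschitzWith 1 f :=
  LipschitzWith.mk_one hf.1

/-- Every point whose image is within `δ` of `b` lies within `δ` of the fiber over `b`. -/
theorem IsSubmetry.preimage_ball_subset_thickening {X B : Type*} [PseudoMetricSpace X]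
    [PseudoMetricSpace B] {f : X → B} (hf : IsSubmetry f) (b : B) (δ : ℝ) :
    f ⁻¹' Metric.ball b δ ⊆ Metric.thickening δ (f ⁻¹' {b}) := by
  intro x hx
  have hδ : 0 < δ := dist_nonneg.trans_lt hx
  obtain ⟨y, hy, hxy⟩ := Metric.exists_edist_lt_of_hausdorffEDist_lt
    (show x ∈ f ⁻¹' {f x} from rfl)
    ((hf.2.2 (f x) b).trans_lt ((ENNReal.ofReal_lt_ofReal_iff hδ).2 hx))
  exact Metric.mem_thickening_iff.2 ⟨y, hy, edist_lt_ofReal.1 hxy⟩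

theorem IsSubmetry.isClosedMap {X B : Type*} [PseudoMetricSpace X] [PseudoMetricSpace B]
    {f : X → B} (hf : IsSubmetry f) (hc : ∀ b : B, IsCompact (f ⁻¹' {b})) : IsClosedMap f := by
  intro C hC
  refine isClosed_of_closure_subset fun b hb ↦ ?_
  by_contra hbC
  have hsub : f ⁻¹' {b} ⊆ Cᶜ := fun x hx hxC ↦ hbC ⟨x, hxC, hx⟩
  obtain ⟨δ, hδ, hthick⟩ := (hc b).exists_thickening_subset_open hC.isOpen_compl hsub
  obtain ⟨_, ⟨x, hxC, rfl⟩, hx⟩ := Metric.mem_closure_iff.1 hb δ hδ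
  exact hthick (hf.preimage_ball_subset_thickening b δ (Metric.mem_ball'.2 hx)) hxC

/-- A submetry between metric spaces is a proper map iff all of its fibers are compact. -/
theorem IsSubmetry.isProperMap_iff_compact_fibers {X B : Type*} [MetricSpace X]
    [MetricSpace B] (f : X → B) (hf : IsSubmetry f) :
    IsProperMap f ↔ ∀ b : B, IsCompact (f ⁻¹' {b}) := by
  rw [isProperMap_iff_isClosedMap_and_compact_fibers]
  exact ⟨fun h ↦ h.2.2, fun h ↦ ⟨hf.lipschitzWith.continuous, hf.isClosedMap h, h⟩⟩
end

section
/- Let f : X → Y and g : Y → Z be local submetries between metric spaces. Then the composite g ∘ f : X → Z is a local submetry. -/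
/-- A map between metric spaces is a local submetry if it is 1-Lipschitz and every point
has a radius \`r > 0\` such that for every nearby point \`x'\` and every sufficiently small
\`s\`, the image of the ball of radius \`s\` around \`x'\` is the ball of radius \`s\` around
\`f x'\`. -/
def IsLocalSubmetry {X Y : Type*} [MetricSpace X] [MetricSpace Y] (f : X → Y) : Prop :=
  (∀ x x', dist (f x) (f x') ≤ dist x x') ∧
    ∀ x : X, ∃ r : ℝ, 0 < r ∧ ∀ x' : X, dist x x' < r →
      ∀ s : ℝ, 0 < s → s < r - dist x x' →
        f '' Metric.ball x' s = Metric.ball (f x') s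

/-- The composite of two local submetries is a local submetry. -/
theorem IsLocalSubmetry.comp {X Y Z : Type*} [MetricSpace X] [MetricSpace Y] [MetricSpace Z]
    (f : X → Y) (g : Y → Z) (hf : IsLocalSubmetry f) (hg : IsLocalSubmetry g) :
    IsLocalSubmetry (g ∘ f) := by
  refine ⟨fun x x' => (hg.1 _ _).trans (hf.1 x x'), fun x => ?_⟩
  obtain ⟨r, hr, hfr⟩ := hf.2 x
  obtain ⟨t, ht, hgt⟩ := hg.2 (f x)
  refine ⟨min r t, lt_min hr ht, fun x' hx' s hs hs' => ?_⟩
  have hdist := hf.1 x x'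
  have hmin_r := min_le_left r t
  have hmin_t := min_le_right r t
  rw [Set.image_comp, hfr x' (by linarith) s hs (by linarith),
    hgt (f x') (by linarith) s hs (by linarith), Function.comp_apply]
end

section
/- Let f : X → Y be a local submetry between metric spaces and let q : Y' → Y be a 1-Lipschitz map from a metric space Y'. Then the natural projection from the fiber product X ×_Y Y' = {p : X × Y' // f p.1 = q p.2} (a subtype of the product X × Y' with the max metric) onto Y' is a local submetry. -/
/-- Base change of a local submetry along a 1-Lipschitz map is a local submetry: the
projection from the fiber product `{p : X × Y' // f p.1 = q p.2}` (with the max metric)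
onto `Y'` is a local submetry. -/
theorem IsLocalSubmetry.base_change {X Y Y' : Type*} [MetricSpace X] [MetricSpace Y]
    [MetricSpace Y'] (f : X → Y) (q : Y' → Y)
    (hf : IsLocalSubmetry f) (hq : ∀ y y', dist (q y) (q y') ≤ dist y y') :
    IsLocalSubmetry (fun p : {p : X × Y' // f p.1 = q p.2} => p.val.2) := by
  refine ⟨fun p p' => le_max_right _ _, fun p => ?_⟩
  obtain ⟨r, hr, hball⟩ := hf.2 p.val.1
  refine ⟨r, hr, fun p' hp' s hs hsr => Set.Subset.antisymm ?_ ?_⟩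
  · rintro _ ⟨w, hw, rfl⟩
    have hle : dist w.val.2 p'.val.2 ≤ dist w p' := le_max_right _ _
    exact hle.trans_lt hw
  · intro z hz
    have hle : dist p.val.1 p'.val.1 ≤ dist p p' := le_max_left _ _
    have hqz : q z ∈ Metric.ball (f p'.val.1) s := by
      rw [p'.property]
      exact lt_of_le_of_lt (hq _ _) hz
    rw [← hball p'.val.1 (by linarith) s hs (by linarith)] at hqz
    obtain ⟨w, hw, hwz⟩ := hqz
    refine ⟨⟨(w, z), hwz⟩, ?_, rfl⟩
    rw [Metric.mem_ball, Subtype.dist_eq, Prod.dist_eq]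
    exact max_lt hw hz
end

section
/- Let X, Y and U_i (i ∈ I) be totally bounded metric spaces, let {f_i : U_i → X}_{i ∈ I} be an lsm covering of X, and let f : Y → X be a 1-Lipschitz map. Then the family of natural projections {U_i ×_X Y → Y}_{i ∈ I}, where U_i ×_X Y = {p : U_i × Y // f_i p.1 = f p.2} is the fiber product with the max metric, is an lsm covering of Y. -/
/-- A family of 1-Lipschitz maps \`f i : U i → X\` between metric spaces is an lsm
covering of \`X\` if each \`f i\` is a local submetry and any three points of \`X\` can be
simultaneously lifted to some \`U i\` with distances increased by at most \`ε\`. -/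
def IsLsmCovering {I : Type*} {X : Type*} [MetricSpace X] {U : I → Type*}
    [∀ i, MetricSpace (U i)] (f : ∀ i, U i → X) : Prop :=
  (∀ i, IsLocalSubmetry (f i)) ∧
    ∀ x₁ x₂ x₃ : X, ∀ ε : ℝ, 0 < ε →
      ∃ i, ∃ u₁ ∈ f i ⁻¹' {x₁}, ∃ u₂ ∈ f i ⁻¹' {x₂}, ∃ u₃ ∈ f i ⁻¹' {x₃},
        dist u₁ u₂ < dist x₁ x₂ + ε ∧ dist u₂ u₃ < dist x₂ x₃ + ε

/-- The pullback of a local submetry along a 1-Lipschitz map is a local submetry. -/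
theorem IsLocalSubmetry.pullback_snd {U X Y : Type*} [MetricSpace U] [MetricSpace X]
    [MetricSpace Y] {g : U → X} {f : Y → X} (hg : IsLocalSubmetry g)
    (hf : ∀ y y', dist (f y) (f y') ≤ dist y y') :
    IsLocalSubmetry (fun p : {p : U × Y // g p.1 = f p.2} => p.val.2) := by
  refine ⟨fun p q => le_max_right _ _, fun p => ?_⟩
  obtain ⟨r, hr, hball⟩ := hg.2 p.val.1
  refine ⟨r, hr, fun q hq s hs hsr => Set.Subset.antisymm ?_ fun y hy => ?_⟩
  · rintro _ ⟨q', hq', rfl⟩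
    exact (le_max_right _ _ : _ ≤ dist q' q).trans_lt hq'
  · have hle : dist p.val.1 q.val.1 ≤ dist p q := le_max_left _ _
    have hfy : f y ∈ Metric.ball (g q.val.1) s := by
      rw [q.property]
      exact (hf _ _).trans_lt hy
    rw [← hball q.val.1 (hle.trans_lt hq) s hs (by linarith)] at hfy
    obtain ⟨u, hu, huy⟩ := hfy
    exact ⟨⟨(u, y), huy⟩,
      Metric.mem_ball.2 (max_lt (Metric.mem_ball.1 hu) (Metric.mem_ball.1 hy)), rfl⟩

/-- Base change of an lsm covering along a 1-Lipschitz map between totally bounded metric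
spaces is an lsm covering. -/
theorem IsLsmCovering.base_change {I : Type*} {X Y : Type*} [MetricSpace X] [MetricSpace Y]
    {U : I → Type*} [∀ i, MetricSpace (U i)] (fI : ∀ i, U i → X) (f : Y → X)
    (hX : TotallyBounded (Set.univ : Set X)) (hY : TotallyBounded (Set.univ : Set Y))
    (hU : ∀ i, TotallyBounded (Set.univ : Set (U i)))
    (hcov : IsLsmCovering fI)
    (hf : ∀ y y', dist (f y) (f y') ≤ dist y y') :
    IsLsmCovering (fun i => (fun p : {p : U i × Y // fI i p.1 = f p.2} => p.val.2)) := by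
  refine ⟨fun i => (hcov.1 i).pullback_snd hf, fun y₁ y₂ y₃ ε hε => ?_⟩
  obtain ⟨i, u₁, h₁, u₂, h₂, u₃, h₃, h₁₂, h₂₃⟩ := hcov.2 (f y₁) (f y₂) (f y₃) ε hε
  have hlt {u u' : U i} {y y' : Y} (h : dist u u' < dist (f y) (f y') + ε) :
      max (dist u u') (dist y y') < dist y y' + ε :=
    max_lt (h.trans_le (by gcongr; exact hf y y')) (lt_add_of_pos_right _ hε)
  exact ⟨i, ⟨(u₁, y₁), h₁⟩, rfl, ⟨(u₂, y₂), h₂⟩, rfl, ⟨(u₃, y₃), h₃⟩, rfl, hlt h₁₂, hlt h₂₃⟩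
end

section
/- Let T and U_i (i ∈ I) be totally bounded metric spaces, let {f_i : U_i → T}_{i ∈ I} be an lsm covering of T, let X be an extended pseudometric space (PseudoEMetricSpace), and for each i ∈ I let g_i : U_i → X be a 1-Lipschitz map (edist (g_i u) (g_i u') ≤ ENNReal.ofReal (dist u u')). Assume the compatibility condition: for all i, j ∈ I and all u : U_i, v : U_j with f_i u = f_j v, one has g_i u = g_j v. Then there exists a unique 1-Lipschitz map g : T → X such that g ∘ f_i = g_i for every i ∈ I. -/
/-- Gluing of 1-Lipschitz maps along an lsm covering: compatible 1-Lipschitz maps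
`g i : U i → X` into an extended pseudometric space descend uniquely to a 1-Lipschitz
map `g : T → X` with `g ∘ f i = g i` for all `i`. -/
theorem IsLsmCovering.glue {I : Type*} {T : Type*} [MetricSpace T]
    {U : I → Type*} [∀ i, MetricSpace (U i)] (f : ∀ i, U i → T)
    {X : Type*} [PseudoEMetricSpace X]
    (hT : TotallyBounded (Set.univ : Set T))
    (hU : ∀ i, TotallyBounded (Set.univ : Set (U i)))
    (hcov : IsLsmCovering f)
    (g : ∀ i, U i → X)
    (hg : ∀ i, ∀ u u' : U i, edist (g i u) (g i u') ≤ ENNReal.ofReal (dist u u'))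
    (hcompat : ∀ i j, ∀ (u : U i) (v : U j), f i u = f j v → g i u = g j v) :
    ∃! G : T → X,
      (∀ t t' : T, edist (G t) (G t') ≤ ENNReal.ofReal (dist t t')) ∧
        ∀ i, G ∘ f i = g i := by
  choose i u hu using fun t : T =>
    let ⟨i, u, hu, _⟩ := hcov.2 t t t 1 one_pos
    (⟨i, u, hu⟩ : ∃ i, ∃ u : U i, f i u = t)
  have hG : ∀ j (v : U j), g (i (f j v)) (u (f j v)) = g j v := fun j v =>
    hcompat _ _ _ _ (hu _)
  refine ⟨fun t => g (i t) (u t), ⟨fun t t' => ?_, fun j => funext (hG j)⟩, ?_⟩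
  · refine ENNReal.le_of_forall_pos_le_add fun ε hε _ => ?_
    obtain ⟨j, v, hv, v', hv', -, -, hd, -⟩ := hcov.2 t t' t' ε hε
    beta_reduce
    rw [hcompat _ j _ v ((hu t).trans hv.symm), hcompat _ j _ v' ((hu t').trans hv'.symm)]
    calc edist (g j v) (g j v') ≤ ENNReal.ofReal (dist v v') := hg j v v'
      _ ≤ ENNReal.ofReal (dist t t' + ε) := ENNReal.ofReal_le_ofReal hd.le
      _ = ENNReal.ofReal (dist t t') + ε := by
        rw [ENNReal.ofReal_add dist_nonneg ε.coe_nonneg, ENNReal.ofReal_coe_nnreal]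
  · rintro G ⟨-, hGf⟩
    funext t
    rw [← hGf, Function.comp_apply, hu]
end

section
/- Let B and U_i (i ∈ I) be totally bounded metric spaces, let {f_i : U_i → B}_{i ∈ I} be an lsm covering of B, let X be a metric space, and let p : X → B be a 1-Lipschitz map. Then p is a submetry all of whose fibers p ⁻¹' {b} are compact if and only if, for every i ∈ I, the natural projection from the fiber product X ×_B U_i = {q : X × U_i // p q.1 = f_i q.2} (with the max metric) onto U_i is a submetry all of whose fibers are compact. -/
/-- A submetry with compact fibers lifts points along the base without increasing distance. -/
theorem IsSubmetry.exists_dist_le {X B : Type*} [PseudoMetricSpace X] [PseudoMetricSpace B]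
    {f : X → B} (hf : IsSubmetry f) (hc : ∀ b, IsCompact (f ⁻¹' {b})) (x : X) (b : B) :
    ∃ x', f x' = b ∧ dist x x' ≤ dist (f x) b := by
  obtain ⟨y, hy⟩ := hf.2.1 b
  obtain ⟨x', hx', h⟩ := (hc b).exists_infEDist_eq_edist ⟨y, hy⟩ x
  refine ⟨x', hx', ?_⟩
  have hle : edist x x' ≤ ENNReal.ofReal (dist (f x) b) :=
    h ▸ (Metric.infEDist_le_hausdorffEDist_of_mem (s := f ⁻¹' {f x}) rfl).trans (hf.2.2 (f x) b)
  rwa [edist_dist, ENNReal.ofReal_le_ofReal_iff dist_nonneg] at hle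

/-- A surjective 1-Lipschitz map that lifts points along the base, up to an arbitrarily small
error, is a submetry. -/
theorem IsSubmetry.of_exists_dist_le_add {X B : Type*} [PseudoMetricSpace X]
    [PseudoMetricSpace B] {f : X → B} (hlip : ∀ x x', dist (f x) (f x') ≤ dist x x')
    (hsurj : Function.Surjective f)
    (hlift : ∀ x b, ∀ ε : ℝ, 0 < ε → ∃ x', f x' = b ∧ dist x x' ≤ dist (f x) b + ε) :
    IsSubmetry f := by
  have key : ∀ b₀ b₁ : B, ∀ x ∈ f ⁻¹' {b₀},
      Metric.infEDist x (f ⁻¹' {b₁}) ≤ ENNReal.ofReal (dist b₀ b₁) := by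
    rintro _ b₁ x rfl
    refine ENNReal.le_of_forall_pos_le_add fun ε hε _ => ?_
    obtain ⟨x', hx', hd⟩ := hlift x b₁ ε hε
    refine (Metric.infEDist_le_edist_of_mem (s := f ⁻¹' {b₁}) hx').trans ?_
    rw [edist_dist, ← ENNReal.ofReal_coe_nnreal, ← ENNReal.ofReal_add dist_nonneg ε.coe_nonneg]
    exact ENNReal.ofReal_le_ofReal hd
  exact ⟨hlip, hsurj, fun b₀ b₁ =>
    Metric.hausdorffEDist_le_of_infEDist (key b₀ b₁) (dist_comm b₁ b₀ ▸ key b₁ b₀)⟩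

/-- Being a proper submetry (a submetry with compact fibers) is local on the base with
respect to lsm coverings. -/
theorem isSubmetry_compact_fibers_iff_of_lsmCovering {I : Type*} {X B : Type*}
    [MetricSpace X] [MetricSpace B] {U : I → Type*} [∀ i, MetricSpace (U i)]
    (fI : ∀ i, U i → B) (p : X → B)
    (hB : TotallyBounded (Set.univ : Set B))
    (hU : ∀ i, TotallyBounded (Set.univ : Set (U i)))
    (hcov : IsLsmCovering fI)
    (hp : ∀ x x', dist (p x) (p x') ≤ dist x x') :
    (IsSubmetry p ∧ ∀ b : B, IsCompact (p ⁻¹' {b})) ↔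
      ∀ i, IsSubmetry (fun q : {q : X × U i // p q.1 = fI i q.2} => q.val.2) ∧
        ∀ u : U i, IsCompact
          ((fun q : {q : X × U i // p q.1 = fI i q.2} => q.val.2) ⁻¹' {u}) := by
  constructor
  · rintro ⟨hsub, hc⟩ i
    constructor
    · refine IsSubmetry.of_exists_dist_le_add (fun q q' => le_max_right _ _) (fun u => ?_) ?_
      · obtain ⟨x, hx⟩ := hsub.2.1 (fI i u)
        exact ⟨⟨(x, u), hx⟩, rfl⟩
      · rintro ⟨⟨x, u⟩, hq⟩ u' ε hε
        obtain ⟨x', hx', hd⟩ := hsub.exists_dist_le hc x (fI i u')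
        refine ⟨⟨(x', u'), hx'⟩, rfl, le_add_of_le_of_nonneg (max_le (hd.trans ?_) le_rfl) hε.le⟩
        exact (congrArg (dist · (fI i u')) hq).trans_le ((hcov.1 i).1 u u')
    · intro u
      rw [Topology.IsEmbedding.subtypeVal.isCompact_iff]
      convert (hc (fI i u)).prod (isCompact_singleton (x := u)) using 1
      ext ⟨x, v⟩
      constructor
      · rintro ⟨⟨_, hq⟩, rfl, rfl⟩
        exact ⟨hq, rfl⟩
      · rintro ⟨hx, rfl⟩
        exact ⟨⟨(x, v), hx⟩, rfl, rfl⟩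
  · intro h
    have hlift : ∀ x b, ∀ ε : ℝ, 0 < ε → ∃ x', p x' = b ∧ dist x x' ≤ dist (p x) b + ε := by
      intro x b ε hε
      obtain ⟨i, u₁, hu₁, u₂, hu₂, -, -, hd, -⟩ := hcov.2 (p x) b b ε hε
      obtain ⟨⟨⟨x', _⟩, hq⟩, rfl, hq'⟩ :=
        (h i).1.exists_dist_le (h i).2 ⟨(x, u₁), Eq.symm hu₁⟩ u₂
      exact ⟨x', hq.trans hu₂, (le_max_left _ _).trans (hq'.trans hd.le)⟩
    have hcover : ∀ b, ∃ i, ∃ u, fI i u = b := fun b => by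
      obtain ⟨i, u, hu, -⟩ := hcov.2 b b b 1 one_pos
      exact ⟨i, u, hu⟩
    refine ⟨IsSubmetry.of_exists_dist_le_add hp (fun b => ?_) hlift, fun b => ?_⟩
    · obtain ⟨i, u, rfl⟩ := hcover b
      obtain ⟨⟨⟨x, _⟩, hq⟩, rfl⟩ := (h i).1.2.1 u
      exact ⟨x, hq⟩
    · obtain ⟨i, u, rfl⟩ := hcover b
      convert ((h i).2 u).image (continuous_fst.comp continuous_subtype_val) using 1
      ext x
      constructor
      · intro hx
        exact ⟨⟨(x, u), hx⟩, rfl, rfl⟩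
      · rintro ⟨⟨_, hq⟩, rfl, rfl⟩
        exact hq
end

section
/- Let X and Y be nonempty compact metric spaces and let r be a real number with r strictly greater than the Gromov–Hausdorff distance between X and Y (GromovHausdorff.ghDist X Y < r). Then there exist a metric space Z and isometric embeddings i : X → Z and j : Y → Z (∀ a a', dist (i a) (i a') = dist a a', and likewise for j) such that for every x : X, Metric.infDist (i x) (Set.range j) = r, and for every y : Y, Metric.infDist (j y) (Set.range i) = r. In particular, Metric.hausdorffDist (Set.range i) (Set.range j) = r. -/
universe u v

open Metric Set

/-- Given maps `f : X → W` and `g : Y → W` into a common space, the function on `X ⊕ Y` which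
restricts to the distances of `X` and `Y`, and which sends a point `x` of `X` and a point `y` of
`Y` to `max r (dist (f x) (g y))`. -/
def sumMaxDist {X Y W : Type*} [Dist X] [Dist Y] [Dist W] (f : X → W) (g : Y → W) (r : ℝ) :
    X ⊕ Y → X ⊕ Y → ℝ
  | .inl a, .inl b => dist a b
  | .inr a, .inr b => dist a b
  | .inl a, .inr b => max r (dist (f a) (g b))
  | .inr a, .inl b => max r (dist (f b) (g a))

/-- If `f` and `g` are isometries and `r` is positive, then `sumMaxDist f g r` is a metric. -/
abbrev sumMaxMetricSpace {X Y W : Type*} [MetricSpace X] [MetricSpace Y] [MetricSpace W]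
    {f : X → W} {g : Y → W} (hf : Isometry f) (hg : Isometry g) {r : ℝ} (hr : 0 < r) :
    MetricSpace (X ⊕ Y) where
  dist := sumMaxDist f g r
  dist_self := by rintro (a | a) <;> simp [sumMaxDist]
  dist_comm := by rintro (a | a) (b | b) <;> simp [sumMaxDist, dist_comm]
  dist_triangle := by
    rintro (a | a) (b | b) (c | c) <;> simp only [sumMaxDist]
    · exact dist_triangle a b c
    · have := dist_triangle (f a) (f b) (g c)
      rw [hf.dist_eq] at this
      have := dist_nonneg (x := a) (y := b)
      grind
    · have := dist_triangle_right (f a) (f c) (g b)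
      rw [hf.dist_eq] at this
      grind
    · have := dist_triangle (f a) (g b) (g c)
      rw [hg.dist_eq] at this
      have := dist_nonneg (x := b) (y := c)
      grind
    · have := dist_triangle (f c) (f b) (g a)
      rw [hf.dist_eq, dist_comm c b] at this
      have := dist_nonneg (x := b) (y := c)
      grind
    · have := dist_triangle_left (g a) (g c) (f b)
      rw [hg.dist_eq] at this
      grind
    · have := dist_triangle (f c) (g b) (g a)
      rw [hg.dist_eq, dist_comm b a] at this
      have := dist_nonneg (x := a) (y := b)
      grind
    · exact dist_triangle a b c
  eq_of_dist_eq_zero := by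
    rintro (a | a) (b | b) h
    · exact congrArg Sum.inl (dist_eq_zero.1 h)
    · exact absurd h (hr.trans_le (le_max_left _ _)).ne'
    · exact absurd h (hr.trans_le (le_max_left _ _)).ne'
    · exact congrArg Sum.inr (dist_eq_zero.1 h)

/-- If all points of a set are at distance at least `r` from `x`, and one of them at distance
exactly `r`, then the distance from `x` to the set is `r`. -/
theorem Metric.infDist_eq_of_forall_le_of_mem {Z : Type*} [PseudoMetricSpace Z] {s : Set Z}
    {x y : Z} {r : ℝ} (h : ∀ z ∈ s, r ≤ dist x z) (hy : y ∈ s) (hxy : dist x y = r) :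
    infDist x s = r :=
  le_antisymm (hxy ▸ infDist_le_dist_of_mem hy) ((le_infDist ⟨y, hy⟩).2 fun {z} hz => h z hz)

/-- The range of an isometry defined on a compact space is bounded. -/
theorem Isometry.isBounded_range {X Z : Type*} [PseudoMetricSpace X] [CompactSpace X]
    [PseudoMetricSpace Z] {f : X → Z} (hf : Isometry f) : Bornology.IsBounded (range f) :=
  (isCompact_range hf.continuous).isBounded

/-- Two bounded nonempty sets, each consisting of points at distance `r` from the other one, are at
Hausdorff distance `r`. -/
theorem Metric.hausdorffDist_eq_of_infDist_eq {Z : Type*} [PseudoMetricSpace Z] {s t : Set Z}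
    {r : ℝ} (hs : s.Nonempty) (ht : t.Nonempty) (bs : Bornology.IsBounded s)
    (bt : Bornology.IsBounded t) (hst : ∀ x ∈ s, infDist x t = r)
    (hts : ∀ x ∈ t, infDist x s = r) : hausdorffDist s t = r := by
  obtain ⟨x, hx⟩ := hs
  have hr : 0 ≤ r := hst x hx ▸ infDist_nonneg
  refine le_antisymm (hausdorffDist_le_of_infDist hr (fun y hy => (hst y hy).le)
    fun y hy => (hts y hy).le) ?_
  rw [← hst x hx]
  exact infDist_le_hausdorffDist_of_mem hx
    (hausdorffEDist_ne_top_of_nonempty_of_bounded ⟨x, hx⟩ ht bs bt)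

/-- If `r` is strictly larger than the Gromov–Hausdorff distance between nonempty compact
metric spaces `X` and `Y`, then `X` and `Y` can be isometrically embedded in a common
metric space `Z` in such a way that every point of (the copy of) `X` is at distance
exactly `r` from the copy of `Y` and vice versa; in particular the Hausdorff distance
between the two copies is exactly `r`. -/
theorem exists_embeddings_infDist_eq_of_ghDist_lt {X : Type u} {Y : Type v}
    [MetricSpace X] [CompactSpace X] [Nonempty X]
    [MetricSpace Y] [CompactSpace Y] [Nonempty Y]
    (r : ℝ) (hr : GromovHausdorff.ghDist X Y < r) :
    ∃ (Z : Type (max u v)) (_ : MetricSpace Z) (i : X → Z) (j : Y → Z),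
      (∀ a a', dist (i a) (i a') = dist a a') ∧
      (∀ b b', dist (j b) (j b') = dist b b') ∧
      (∀ x, Metric.infDist (i x) (Set.range j) = r) ∧
      (∀ y, Metric.infDist (j y) (Set.range i) = r) ∧
      Metric.hausdorffDist (Set.range i) (Set.range j) = r := by
  obtain ⟨f, g, hf, hg, hfg⟩ := GromovHausdorff.ghDist_eq_hausdorffDist X Y
  rw [hfg] at hr
  have hr0 : 0 < r := hausdorffDist_nonneg.trans_lt hr
  have hfin : hausdorffEDist (range f) (range g) ≠ ⊤ :=
    hausdorffEDist_ne_top_of_nonempty_of_bounded (range_nonempty f) (range_nonempty g)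
      hf.isBounded_range hg.isBounded_range
  let m : MetricSpace (X ⊕ Y) := sumMaxMetricSpace hf hg hr0
  have hinl : Isometry (Sum.inl : X → X ⊕ Y) := Isometry.of_dist_eq fun _ _ => rfl
  have hinr : Isometry (Sum.inr : Y → X ⊕ Y) := Isometry.of_dist_eq fun _ _ => rfl
  have hX (x : X) : infDist (Sum.inl x : X ⊕ Y) (range Sum.inr) = r := by
    obtain ⟨_, ⟨y, rfl⟩, hy⟩ := exists_dist_lt_of_hausdorffDist_lt (mem_range_self x) hr hfin
    refine infDist_eq_of_forall_le_of_mem ?_ (mem_range_self y) (max_eq_left hy.le)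
    rintro _ ⟨z, rfl⟩
    exact le_max_left _ _
  have hY (y : Y) : infDist (Sum.inr y : X ⊕ Y) (range Sum.inl) = r := by
    obtain ⟨_, ⟨x, rfl⟩, hx⟩ := exists_dist_lt_of_hausdorffDist_lt' (mem_range_self y) hr hfin
    refine infDist_eq_of_forall_le_of_mem ?_ (mem_range_self x) (max_eq_left hx.le)
    rintro _ ⟨z, rfl⟩
    exact le_max_left _ _
  exact ⟨X ⊕ Y, m, Sum.inl, Sum.inr, hinl.dist_eq, hinr.dist_eq, hX, hY,
    hausdorffDist_eq_of_infDist_eq (range_nonempty _) (range_nonempty _)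
      hinl.isBounded_range hinr.isBounded_range
      (forall_mem_range.2 hX) (forall_mem_range.2 hY)⟩
end
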